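/- arXiv:1605.03512 — 4 statements merged into one kernel-verified Lean document; each statement's English description precedes it below -/
import Mathlib

section
/- For u ∈ W_m and w ∈ W_{m+n+1} (n ≥ 0), the sum over all v ∈ W_{m+1} of binom(v,u)·binom(w,v) equals (n+1)²·binom(w,u). -/
open MeasureTheory ProbabilityTheory

/-- `W n`: words over `{a,b}` (with `true` playing the role of the letter `a` and
`false` the letter `b`) of length `2n` with exactly `n` letters `a`
(and hence `n` letters `b`). -/
def IsWord (n : ℕ) (w : Fin (2*n) → Bool) : Prop :=
  (Finset.univ.filter fun i => w i = true).card = n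

instance (n : ℕ) : DecidablePred (IsWord n) := fun w =>
  decidable_of_iff ((Finset.univ.filter fun i => w i = true).card = n) Iff.rfl

/-- `subwordCount w v` = number of occurrences of `v` as a subword of `w`:
the number of strictly increasing maps `f` from the index set of `v` to the
index set of `w` such that the letter of `w` at `f k` is the letter of `v` at `k`. -/
noncomputable def subwordCount {q p : ℕ} (w : Fin q → Bool) (v : Fin p → Bool) : ℕ :=
  Nat.card {f : Fin p → Fin q // StrictMono f ∧ ∀ k, w (f k) = v k}

open Finset in
open scoped Classical in
theorem subwordCount_eq_card_filter {q p : ℕ} (w : Fin q → Bool) (v : Fin p → Bool) :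
    subwordCount w v = #{f : Fin p → Fin q | StrictMono f ∧ w ∘ f = v} := by
  rw [subwordCount, Nat.card_eq_fintype_card, Fintype.card_subtype]
  simp only [funext_iff, Function.comp_apply]

open Finset in
open scoped Classical in
/-- Occurrences of `u` in a subword `w ∘ g` of `w` are the occurrences of `u` in `w` that lie
inside the range of `g`. -/
theorem subwordCount_comp {q p r : ℕ} (w : Fin q → Bool) (u : Fin r → Bool)
    {g : Fin p → Fin q} (hg : StrictMono g) :
    subwordCount (w ∘ g) u =
      #{h : Fin r → Fin q | (StrictMono h ∧ w ∘ h = u) ∧ Set.range h ⊆ Set.range g} := by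
  rw [subwordCount_eq_card_filter]
  refine card_bij (fun f _ => g ∘ f) ?_ ?_ ?_
  · intro f hf
    simp only [mem_filter, mem_univ, true_and] at hf ⊢
    exact ⟨⟨hg.comp hf.1, hf.2⟩, Set.range_comp_subset_range f g⟩
  · intro f _ f' _ h
    exact hg.injective.comp_left h
  · intro h hh
    simp only [mem_filter, mem_univ, true_and] at hh
    choose f hf using fun i => hh.2 (Set.mem_range_self i)
    have hfh : g ∘ f = h := funext hf
    refine ⟨f, ?_, hfh⟩
    simp only [mem_filter, mem_univ, true_and]
    refine ⟨fun i j hij => ?_, by rw [Function.comp_assoc, hfh, hh.1.2]⟩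
    rw [← hg.lt_iff_lt, hf, hf]
    exact hh.1.1 hij

open Finset in
/-- The number of sets containing `T` together with exactly one further element satisfying `P`
and one further element not satisfying `P`. -/
theorem card_supersets_add_one_add_one {α : Type*} [Fintype α] [DecidableEq α] (P : α → Prop)
    [DecidablePred P] (T : Finset α) :
    #{S : Finset α | T ⊆ S ∧ #{x ∈ S | P x} = #{x ∈ T | P x} + 1 ∧
        #{x ∈ S | ¬ P x} = #{x ∈ T | ¬ P x} + 1} =
      #{x ∈ Tᶜ | P x} * #{x ∈ Tᶜ | ¬ P x} := by
  rw [← card_product]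
  symm
  refine card_bij (fun x _ => insert x.1 (insert x.2 T)) ?_ ?_ ?_
  · rintro ⟨x, y⟩ hxy
    simp only [mem_product, mem_filter, mem_compl] at hxy
    obtain ⟨⟨hx, hPx⟩, hy, hPy⟩ := hxy
    simp only [mem_filter, mem_univ, true_and, filter_insert, hPx, hPy, if_true, if_false,
      not_true_eq_false, not_false_eq_true]
    refine ⟨fun z hz => by simp [hz], ?_, ?_⟩ <;> rw [card_insert_of_notMem] <;> simp [hx, hy]
  · rintro ⟨x, y⟩ hxy ⟨x', y'⟩ hxy' h
    simp only [mem_product, mem_filter, mem_compl] at hxy hxy'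
    have h1 := Finset.ext_iff.1 h x
    have h2 := Finset.ext_iff.1 h y
    simp only [mem_insert] at h1 h2
    grind
  · intro S hS
    simp only [mem_filter, mem_univ, true_and] at hS
    obtain ⟨hTS, h1, h2⟩ := hS
    have key : ∀ (Q : α → Prop) [DecidablePred Q], #{x ∈ S | Q x} = #{x ∈ T | Q x} + 1 →
        ∃ x, {x ∈ S | Q x} \ {x ∈ T | Q x} = {x} := by
      intro Q _ h
      rw [← card_eq_one, card_sdiff_of_subset (filter_subset_filter _ hTS), h]
      omega
    obtain ⟨x, hx⟩ := key _ h1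
    obtain ⟨y, hy⟩ := key _ h2
    simp only [Finset.ext_iff, mem_sdiff, mem_filter, mem_singleton] at hx hy
    refine ⟨(x, y), ?_, ?_⟩
    · have := (hx x).2 rfl
      have := (hy y).2 rfl
      simp only [mem_product, mem_filter, mem_compl]
      tauto
    · ext z
      have := (hx x).2 rfl
      have := (hy y).2 rfl
      have := hx z
      have := hy z
      have := @hTS z
      simp only [mem_insert]
      grind

open Finset in
theorem IsWord.card_filter_ne_true {n : ℕ} {w : Fin (2 * n) → Bool} (hw : IsWord n w) :
    #{i | ¬ w i = true} = n := by
  have h := card_filter_add_card_filter_not (s := univ) (fun i => w i = true)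
  rw [IsWord] at hw
  rw [hw, card_univ, Fintype.card_fin] at h
  omega

open Finset in
theorem card_filter_image_univ {q p : ℕ} (P : Fin q → Prop) [DecidablePred P]
    {g : Fin p → Fin q} (hg : StrictMono g) :
    #{x ∈ univ.image g | P x} = #{i | P (g i)} := by
  rw [filter_image, card_image_of_injective _ hg.injective]

open Finset in
open scoped Classical in
/-- The number of balanced subwords of `w` with `m + 1` letters of each kind containing a given
balanced subword with `m` letters of each kind. -/
theorem card_strictMono_isWord_comp (m n : ℕ) (w : Fin (2 * (m + n + 1)) → Bool)
    (hw : IsWord (m + n + 1) w) {h : Fin (2 * m) → Fin (2 * (m + n + 1))} (hh : StrictMono h)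
    (hu : IsWord m (w ∘ h)) :
    #{g : Fin (2 * (m + 1)) → Fin (2 * (m + n + 1)) |
        (StrictMono g ∧ IsWord (m + 1) (w ∘ g)) ∧ Set.range h ⊆ Set.range g} = (n + 1) ^ 2 := by
  have hT1 : #{x ∈ univ.image h | w x = true} = m :=
    (card_filter_image_univ _ hh).trans hu
  have hT2 : #{x ∈ univ.image h | ¬ w x = true} = m :=
    (card_filter_image_univ _ hh).trans hu.card_filter_ne_true
  have hcompl : ∀ (P : Fin (2 * (m + n + 1)) → Prop) [DecidablePred P], #{x | P x} = m + n + 1 →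
      #{x ∈ univ.image h | P x} = m → #{x ∈ (univ.image h)ᶜ | P x} = n + 1 := by
    intro P _ h1 h2
    have h3 : #{x ∈ (univ.image h)ᶜ | P x} + #{x ∈ univ.image h | P x} = #{x | P x} := by
      rw [← card_union_of_disjoint
        (disjoint_filter_filter disjoint_compl_left), ← filter_union, union_comm, union_compl]
    omega
  have hcard := card_supersets_add_one_add_one (fun x => w x = true) (univ.image h)
  rw [hcompl (fun x => w x = true) hw hT1,
    hcompl (fun x => ¬ w x = true) hw.card_filter_ne_true hT2,
    hT1, hT2, ← sq] at hcard
  rw [← hcard]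
  refine card_bij (fun g _ => univ.image g) ?_ ?_ ?_
  · intro g hg
    simp only [mem_filter, mem_univ, true_and] at hg ⊢
    obtain ⟨⟨hg, hgw⟩, hhg⟩ := hg
    refine ⟨?_, (card_filter_image_univ _ hg).trans hgw,
      (card_filter_image_univ _ hg).trans hgw.card_filter_ne_true⟩
    rw [← coe_subset]
    simpa using hhg
  · intro g hg g' hg' hgg
    simp only [mem_filter, mem_univ, true_and] at hg hg'
    refine (StrictMono.range_inj hg.1.1 hg'.1.1).1 ?_
    simpa using congrArg ((↑) : Finset (Fin (2 * (m + n + 1))) → Set (Fin (2 * (m + n + 1)))) hgg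
  · intro S hS
    simp only [mem_filter, mem_univ, true_and] at hS
    obtain ⟨hTS, h1, h2⟩ := hS
    have hSc : #S = 2 * (m + 1) := by
      rw [← card_filter_add_card_filter_not (s := S) (fun x => w x = true), h1, h2]
      ring
    have himg : univ.image (S.orderEmbOfFin hSc) = S := by
      rw [← coe_inj]
      simp
    have hmono : StrictMono (S.orderEmbOfFin hSc) := (S.orderEmbOfFin hSc).strictMono
    refine ⟨S.orderEmbOfFin hSc, ?_, himg⟩
    simp only [mem_filter, mem_univ, true_and]
    refine ⟨⟨hmono, ?_⟩, ?_⟩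
    · refine (card_filter_image_univ (fun x => w x = true) hmono).symm.trans ?_
      rw [himg, h1]
    · rw [range_orderEmbOfFin]
      rw [← coe_subset] at hTS
      simpa using hTS

/-- For `u ∈ W_m` and `w ∈ W_{m+n+1}`, the sum over all `v ∈ W_{m+1}` of
`binom(v,u)·binom(w,v)` equals `(n+1)² · binom(w,u)`. -/
theorem sum_subwordCount_mul_subwordCount (m n : ℕ)
    (u : Fin (2*m) → Bool) (w : Fin (2*(m+n+1)) → Bool)
    (hu : IsWord m u) (hw : IsWord (m+n+1) w) :
    ∑ v ∈ Finset.univ.filter (IsWord (m+1)),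
        subwordCount v u * subwordCount w v
      = (n+1)^2 * subwordCount w u := by
  classical
  let G : Finset (Fin (2 * (m + 1)) → Fin (2 * (m + n + 1))) :=
    {g | StrictMono g ∧ IsWord (m + 1) (w ∘ g)}
  let H : Finset (Fin (2 * m) → Fin (2 * (m + n + 1))) := {h | StrictMono h ∧ w ∘ h = u}
  calc
    _ = ∑ v ∈ Finset.univ.filter (IsWord (m+1)), ∑ g ∈ G with w ∘ g = v,
          subwordCount (w ∘ g) u := by
      refine Finset.sum_congr rfl fun v hv => ?_
      have hv' : IsWord (m + 1) v := (Finset.mem_filter.1 hv).2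
      have hG : {g ∈ G | w ∘ g = v} =
          ({g | StrictMono g ∧ w ∘ g = v} : Finset (Fin (2 * (m + 1)) → _)) := by
        ext g
        simp only [G, Finset.mem_filter, Finset.mem_univ, true_and]
        constructor
        · exact fun h => ⟨h.1.1, h.2⟩
        · exact fun h => ⟨⟨h.1, h.2 ▸ hv'⟩, h.2⟩
      rw [Finset.sum_congr rfl (g := fun _ => subwordCount v u)
        fun g hg => by rw [(Finset.mem_filter.1 hg).2], Finset.sum_const, hG,
        subwordCount_eq_card_filter w v, smul_eq_mul, mul_comm]
    _ = ∑ g ∈ G, subwordCount (w ∘ g) u :=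
      Finset.sum_fiberwise_of_maps_to (fun g hg => by
        simpa using (Finset.mem_filter.1 hg).2.2) _
    _ = ∑ g ∈ G, (H.filter fun h => Set.range h ⊆ Set.range g).card := by
      refine Finset.sum_congr rfl fun g hg => ?_
      rw [subwordCount_comp w u (Finset.mem_filter.1 hg).2.1, Finset.filter_filter]
    _ = ∑ h ∈ H, (G.filter fun g => Set.range h ⊆ Set.range g).card :=
      (Finset.sum_card_bipartiteAbove_eq_sum_card_bipartiteBelow
        (fun h g => Set.range h ⊆ Set.range g)).symm
    _ = ∑ h ∈ H, (n + 1) ^ 2 := by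
      refine Finset.sum_congr rfl fun h hh => ?_
      obtain ⟨hmono, hwu⟩ := (Finset.mem_filter.1 hh).2
      rw [Finset.filter_filter]
      exact card_strictMono_isWord_comp m n w hw hmono (hwu ▸ hu)
    _ = _ := by
      rw [Finset.sum_const, smul_eq_mul, mul_comm, subwordCount_eq_card_filter w u]
end

section
/- Let y ∈ W_N with N ≥ 1, and define discrete probability measures μ_y and ν_y on [0,1] by: μ_y assigns mass 1/N to the point i/(2N) for each position 1 ≤ i ≤ 2N at which the letter of y is a, and ν_y assigns mass 1/N to the point j/(2N) for each position 1 ≤ j ≤ 2N at which the letter of y is b. Then for every m ∈ ℕ and every w ∈ W_m, the product measure μ_y^{⊗m} ⊗ ν_y^{⊗m} of the set S(w) ⊆ ℝ^{2m} equals (m!)² · binom(y,w) / N^{2m}. -/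
open MeasureTheory ProbabilityTheory
open scoped ENNReal

/-- `S(w)` for a word `w ∈ W_m`: the set of points `(x_1,…,x_m,y_1,…,y_m) ∈ ℝ^{2m}`
(the first `m` coordinates being the `x`'s) with all entries distinct whose
interleaving pattern is `w`, i.e. such that the `i`-th smallest of the `2m` values
lies among the `x`'s iff the `i`-th letter of `w` is `a` (= `true`). -/
def interleavingSet (m : ℕ) (w : Fin (2*m) → Bool) : Set (Fin (2*m) → ℝ) :=
  {p | ∃ σ : Equiv.Perm (Fin (2*m)),
    StrictMono (p ∘ σ) ∧ ∀ i, w i = decide ((σ i : ℕ) < m)}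

/-- The discrete measure `μ_y` on `[0,1]` associated with a word `y ∈ W_N`:
mass `1/N` at `i/(2N)` for each position `1 ≤ i ≤ 2N` at which the letter of `y` is `a`. -/
noncomputable def wordMeasA (N : ℕ) (y : Fin (2*N) → Bool) : Measure ℝ :=
  (N : ℝ≥0∞)⁻¹ • ∑ i ∈ Finset.univ.filter (fun i => y i = true),
    Measure.dirac (((i : ℕ) + 1 : ℝ) / (2*N))

/-- The discrete measure `ν_y` on `[0,1]` associated with a word `y ∈ W_N`:
mass `1/N` at `j/(2N)` for each position `1 ≤ j ≤ 2N` at which the letter of `y` is `b`. -/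
noncomputable def wordMeasB (N : ℕ) (y : Fin (2*N) → Bool) : Measure ℝ :=
  (N : ℝ≥0∞)⁻¹ • ∑ j ∈ Finset.univ.filter (fun j => y j = false),
    Measure.dirac (((j : ℕ) + 1 : ℝ) / (2*N))

theorem pi_smul_sum_dirac {ι κ α : Type*} [Fintype ι] [DecidableEq ι] [MeasurableSpace α]
    [MeasurableSingletonClass α] (c : ℝ≥0∞) (hc : c ≠ ∞) (s : ι → Finset κ) (x : κ → α) :
    (Measure.pi fun i => c • ∑ j ∈ s i, Measure.dirac (x j)) =
      c ^ Fintype.card ι • ∑ f ∈ Fintype.piFinset s, Measure.dirac (x ∘ f) := by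
  have : ∀ i, IsFiniteMeasure (c • ∑ j ∈ s i, Measure.dirac (x j)) := fun i =>
    Measure.smul_finite _ hc
  refine Measure.pi_eq fun t _ => ?_
  simp only [Measure.smul_apply, Measure.finsetSum_apply, smul_eq_mul, Measure.dirac_apply,
    Finset.prod_mul_distrib, Finset.prod_const, Finset.card_univ, Finset.prod_univ_sum]
  congr 1
  refine Finset.sum_congr rfl fun f _ => ?_
  classical
  simp [Set.indicator_apply, Finset.prod_ite_zero]

theorem pi_smul_sum_dirac_apply {ι κ α : Type*} [Fintype ι] [Fintype κ]
    [MeasurableSpace α] [MeasurableSingletonClass α] (c : ℝ≥0∞) (hc : c ≠ ∞)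
    (s : ι → Finset κ) (x : κ → α) (S : Set (ι → α)) :
    (Measure.pi fun i => c • ∑ j ∈ s i, Measure.dirac (x j)) S =
      c ^ Fintype.card ι * (Nat.card {f : ι → κ // (∀ i, f i ∈ s i) ∧ x ∘ f ∈ S} : ℝ≥0∞) := by
  classical
  rw [pi_smul_sum_dirac c hc, Measure.smul_apply, Measure.finsetSum_apply, smul_eq_mul]
  simp only [Measure.dirac_apply, Set.indicator_apply, Pi.one_apply, Finset.sum_boole]
  rw [Nat.card_eq_fintype_card, Fintype.card_subtype]
  congr 3
  ext f
  simp

/-- The number of ways of permuting a colouring `d` into the colouring `w` with the same number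
of points of each colour. -/
theorem card_perm_comp_eq {ι κ : Type*} [Fintype ι] [DecidableEq ι] [Fintype κ] [DecidableEq κ]
    (d w : ι → κ) (h : ∀ k, Fintype.card {i // w i = k} = Fintype.card {i // d i = k}) :
    Nat.card {σ : Equiv.Perm ι // ∀ i, w i = d (σ i)} =
      ∏ k, (Fintype.card {i // d i = k}).factorial := by
  let τ : Equiv.Perm ι := Equiv.ofFiberEquiv fun k => Fintype.equivOfCardEq (h k)
  have hτw : ∀ i, d (τ i) = w i := Equiv.ofFiberEquiv_map _
  rw [← DomMulAct.stabilizer_card d, ← Nat.card_eq_fintype_card]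
  refine Nat.card_congr (Equiv.subtypeEquiv (Equiv.mulRight τ⁻¹) fun σ => ?_)
  simp only [funext_iff, Function.comp_apply, Equiv.coe_mulRight, Equiv.Perm.mul_apply]
  rw [← τ.symm.forall_congr_right]
  simp [← hτw, eq_comm]

/-- A map into a linear order which becomes strictly increasing after a permutation of the
source, matching colours, is the same as such a permutation and a strictly increasing map. -/
theorem card_strictMono_comp_perm {ι κ β : Type*} [LinearOrder ι] [Finite ι] [LinearOrder κ]
    (d w : ι → β) (y : κ → β) :
    Nat.card {f : ι → κ // (∀ i, y (f i) = d i) ∧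
        ∃ σ : Equiv.Perm ι, StrictMono (f ∘ σ) ∧ ∀ i, w i = d (σ i)} =
      Nat.card {σ : Equiv.Perm ι // ∀ i, w i = d (σ i)} *
        Nat.card {g : ι → κ // StrictMono g ∧ ∀ i, y (g i) = w i} := by
  rw [← Nat.card_prod]
  symm
  refine Nat.card_congr (Equiv.ofBijective (fun p => ⟨p.2.1 ∘ p.1.1.symm, fun i => ?_,
    p.1.1, ?_, p.1.2⟩) ⟨?_, ?_⟩)
  · simp [p.2.2.2, p.1.2]
  · simpa [Function.comp_assoc] using p.2.2.1
  · rintro ⟨⟨σ, hσ⟩, g, hg, hgw⟩ ⟨⟨τ, hτ⟩, k, hk, hkw⟩ h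
    simp only [Subtype.mk.injEq] at h
    have hgk : g = k := by
      rw [← hg.range_inj hk, ← σ.symm.surjective.range_comp g, h,
        τ.symm.surjective.range_comp]
    subst hgk
    have : σ.symm = τ.symm := Equiv.ext fun i => hg.injective (congrFun h i)
    simpa using Equiv.symm_bijective.injective this
  · rintro ⟨f, hf, σ, hfσ, hσ⟩
    exact ⟨⟨⟨σ, hσ⟩, f ∘ σ, hfσ, fun i => by simp [hf, hσ]⟩, by simp [Function.comp_assoc]⟩

theorem IsWord.card_fiber {n : ℕ} {w : Fin (2*n) → Bool} (hw : IsWord n w) (k : Bool) :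
    Fintype.card {i // w i = k} = n := by
  have ht : Fintype.card {i // w i = true} = n := by
    rw [Fintype.card_subtype]
    exact hw
  cases k with
  | true => exact ht
  | false =>
    have h := Fintype.card_subtype_compl fun i => w i = true
    simp only [Bool.not_eq_true, ht, Fintype.card_fin] at h
    omega

theorem isWord_decide_lt (m : ℕ) : IsWord m fun i : Fin (2*m) => decide ((i : ℕ) < m) := by
  simp only [IsWord, decide_eq_true_eq, Fin.card_filter_val_lt]
  omega

/-- For `y ∈ W_N` with `N ≥ 1` and `w ∈ W_m`,
`μ_y^{⊗m} ⊗ ν_y^{⊗m}(S(w)) = (m!)² · binom(y,w) / N^{2m}`. -/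
theorem wordMeas_interleavingSet (N : ℕ) (hN : 1 ≤ N) (y : Fin (2*N) → Bool)
    (hy : IsWord N y) (m : ℕ) (w : Fin (2*m) → Bool) (hw : IsWord m w) :
    (Measure.pi fun i : Fin (2*m) => if (i : ℕ) < m then wordMeasA N y else wordMeasB N y)
        (interleavingSet m w)
      = (m.factorial : ℝ≥0∞)^2 * (subwordCount y w : ℝ≥0∞) / (N : ℝ≥0∞)^(2*m) := by
  have hN0 : (N : ℝ≥0∞) ≠ 0 := by
    rw [Nat.cast_ne_zero]
    omega
  set d : Fin (2*m) → Bool := fun i => decide ((i : ℕ) < m) with hd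
  set x : Fin (2*N) → ℝ := fun i => ((i : ℕ) + 1 : ℝ) / (2*N) with hx
  have hxm : StrictMono x := by
    intro i j hij
    have hN' : (0 : ℝ) < 2 * N := by positivity
    have : (i : ℝ) < (j : ℝ) := by exact_mod_cast hij
    simp only [hx]
    gcongr
  have hμ : (fun i : Fin (2*m) => if (i : ℕ) < m then wordMeasA N y else wordMeasB N y) =
      fun i => (N : ℝ≥0∞)⁻¹ • ∑ j ∈ Finset.univ.filter (fun j => y j = d i),
        Measure.dirac (x j) := by
    funext i
    by_cases hi : (i : ℕ) < m <;> simp [hi, hd, hx, wordMeasA, wordMeasB]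
  have hcount : Nat.card {f : Fin (2*m) → Fin (2*N) //
      (∀ i, f i ∈ Finset.univ.filter (fun j => y j = d i)) ∧ x ∘ f ∈ interleavingSet m w} =
        m.factorial ^ 2 * subwordCount y w := by
    have hdw : IsWord m d := isWord_decide_lt m
    have hperm := card_perm_comp_eq d w fun k => by rw [hw.card_fiber, hdw.card_fiber]
    simp only [hdw.card_fiber, Finset.prod_const, Finset.card_univ, Fintype.card_bool] at hperm
    rw [subwordCount, ← hperm, ← card_strictMono_comp_perm]
    refine Nat.card_congr (Equiv.subtypeEquivRight fun f => ?_)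
    simp only [Finset.mem_filter_univ, interleavingSet, Set.mem_ofPred_eq, Function.comp_assoc]
    have hcomp : ∀ g : Fin (2*m) → Fin (2*N), StrictMono (x ∘ g) ↔ StrictMono g := fun g =>
      ⟨fun h _ _ hab => hxm.lt_iff_lt.1 (h hab), hxm.comp⟩
    simp only [hcomp, hd]
  rw [hμ, pi_smul_sum_dirac_apply _ (ENNReal.inv_ne_top.2 hN0), hcount, Fintype.card_fin,
    ENNReal.div_eq_inv_mul, ENNReal.inv_pow]
  push_cast
  rfl
end

section
/- Let α, β > 0 and let Exp(α), Exp(β) denote the exponential distributions on ℝ with rate parameters α and β (density α e^{-αx} on [0,∞), resp. β e^{-βx}). Then for every n ∈ ℕ and every u ∈ W_n, Exp(α)^{⊗n} ⊗ Exp(β)^{⊗n}(S(u)) = (n!)² α^n β^n ∏_{i=1}^{2n} 1/(A_i^n(u)·α + B_i^n(u)·β), where A_i^n(u) := #{i ≤ j ≤ 2n : u_j = a} and B_i^n(u) := #{i ≤ j ≤ 2n : u_j = b}. -/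
open MeasureTheory ProbabilityTheory
open scoped ENNReal

lemma measurableSet_setOf_strictMono {ι : Type*} [Preorder ι] [Countable ι] :
    MeasurableSet {x : ι → ℝ | StrictMono x} := by
  simp only [StrictMono, Set.ofPred_forall]
  exact MeasurableSet.iInter fun i => MeasurableSet.iInter fun j => MeasurableSet.iInter fun _ =>
    measurableSet_lt (measurable_pi_apply i) (measurable_pi_apply j)

lemma ae_expMeasure_pos (r : ℝ) : ∀ᵐ x ∂expMeasure r, 0 < x := by
  have h : expMeasure r (Set.Iic 0) = 0 := by
    rw [expMeasure, gammaMeasure, withDensity_apply _ measurableSet_Iic,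
      ← setLIntegral_congr Iio_ae_eq_Iic]
    exact lintegral_gammaPDF_of_nonpos le_rfl
  rw [ae_iff]
  convert h using 2
  ext x
  simp

lemma setLIntegral_exp_expMeasure {r R t : ℝ} (hr : 0 < r) (hR : 0 ≤ R) (ht : 0 ≤ t) :
    ∫⁻ x in Set.Ioi t, ENNReal.ofReal (Real.exp (-(R * x))) ∂expMeasure r =
      ENNReal.ofReal (r * (r + R)⁻¹ * Real.exp (-((r + R) * t))) := by
  have hneg : -(r + R) < 0 := by linarith
  have hpdf : Measurable (gammaPDF 1 r) := (measurable_gammaPDFReal 1 r).ennreal_ofReal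
  rw [expMeasure, gammaMeasure, restrict_withDensity measurableSet_Ioi,
    lintegral_withDensity_eq_lintegral_mul _ hpdf (by fun_prop)]
  calc ∫⁻ x in Set.Ioi t, (gammaPDF 1 r * fun x => ENNReal.ofReal (Real.exp (-(R * x)))) x
      = ∫⁻ x in Set.Ioi t, ENNReal.ofReal (r * Real.exp (-(r + R) * x)) := by
        refine setLIntegral_congr_fun measurableSet_Ioi fun x hx => ?_
        have hx0 : 0 ≤ x := ht.trans (le_of_lt hx)
        change exponentialPDF r x * _ = _
        rw [exponentialPDF_of_nonneg hx0, ← ENNReal.ofReal_mul (by positivity), mul_assoc,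
          ← Real.exp_add]
        ring_nf
    _ = ENNReal.ofReal (∫ x in Set.Ioi t, r * Real.exp (-(r + R) * x)) := by
        refine (ofReal_integral_eq_lintegral_ofReal ?_ ?_).symm
        · exact (integrableOn_exp_mul_Ioi hneg t).const_mul r
        · exact ae_of_all _ fun x => by positivity
    _ = _ := by
        rw [integral_const_mul, integral_exp_mul_Ioi hneg, neg_div_neg_eq, neg_mul]
        ring_nf

/-- The probability that independent exponential variables with rates `r 0, …, r (N - 1)` satisfy
`t < X 0 < ⋯ < X (N - 1)`. -/
lemma pi_expMeasure_strictMono_vecCons {N : ℕ} (r : Fin N → ℝ) (hr : ∀ i, 0 < r i) {t : ℝ}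
    (ht : 0 ≤ t) :
    (Measure.pi fun i => expMeasure (r i)) {x | StrictMono (Matrix.vecCons t x)} =
      ENNReal.ofReal ((∏ i, r i * (∑ j with i ≤ j, r j)⁻¹) *
        Real.exp (-((∑ i, r i) * t))) := by
  induction N generalizing t with
  | zero =>
    have h : {x : Fin 0 → ℝ | StrictMono (Matrix.vecCons t x)} = Set.univ :=
      Set.eq_univ_of_forall fun x i j hij => absurd hij (by omega)
    simp [h]
  | succ N ih =>
    have (i : Fin (N + 1)) := isProbabilityMeasure_expMeasure (hr i)
    have hms : MeasurableSet
        {p : ℝ × (Fin N → ℝ) | t < p.1 ∧ StrictMono (Matrix.vecCons p.1 p.2)} := by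
      refine (measurableSet_lt measurable_const measurable_fst).inter
        (measurableSet_setOf_strictMono.preimage
          (f := fun p : ℝ × (Fin N → ℝ) => Matrix.vecCons p.1 p.2) ?_)
      refine measurable_pi_iff.2 (Fin.cases ?_ fun j => ?_)
      · exact measurable_fst
      · exact (measurable_pi_apply j).comp measurable_snd
    have hpre : {x : Fin (N + 1) → ℝ | StrictMono (Matrix.vecCons t x)} =
        MeasurableEquiv.piFinSuccAbove (fun _ => ℝ) 0 ⁻¹'
          {p | t < p.1 ∧ StrictMono (Matrix.vecCons p.1 p.2)} := by
      ext x
      have hx : Matrix.vecCons (x 0) (fun j => x (Fin.succ j)) = x := Fin.cons_self_tail x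
      change _ ↔ t < x 0 ∧ StrictMono (Matrix.vecCons (x 0) fun j => x (Fin.succ j))
      rw [hx]
      exact strictMono_vecCons
    set C := ∏ i : Fin N, r i.succ * (∑ j with i ≤ j, r j.succ)⁻¹ with hC
    have hC0 : 0 ≤ C := Finset.prod_nonneg fun i _ =>
      mul_nonneg (hr _).le (inv_nonneg.2 (Finset.sum_nonneg fun j _ => (hr _).le))
    rw [hpre,
      (measurePreserving_piFinSuccAbove (fun i => expMeasure (r i)) 0).measure_preimage_equiv,
      Measure.prod_apply hms]
    have hsec (x : ℝ) : (Measure.pi fun j : Fin N => expMeasure (r (Fin.succAbove 0 j)))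
        (Prod.mk x ⁻¹' {p | t < p.1 ∧ StrictMono (Matrix.vecCons p.1 p.2)}) =
        (Set.Ioi t).indicator (fun x => ENNReal.ofReal C *
          ENNReal.ofReal (Real.exp (-((∑ i : Fin N, r i.succ) * x)))) x := by
      by_cases hx : t < x
      · rw [Set.indicator_of_mem (Set.mem_Ioi.2 hx), ← ENNReal.ofReal_mul hC0, hC,
          ← ih (fun i => r i.succ) (fun i => hr _) (ht.trans hx.le)]
        simp [hx]
      · rw [Set.indicator_of_notMem (by simpa using hx)]
        simp [hx]
    simp_rw [hsec]
    rw [lintegral_indicator measurableSet_Ioi, lintegral_const_mul _ (by fun_prop),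
      setLIntegral_exp_expMeasure (hr 0) (Finset.sum_nonneg fun i _ => (hr _).le) ht,
      ← ENNReal.ofReal_mul hC0]
    have hsucc (i : Fin N) :
        ∑ j : Fin (N + 1) with i.succ ≤ j, r j = ∑ j : Fin N with i ≤ j, r j.succ := by
      simp [Finset.sum_filter, Fin.sum_univ_succ]
    congr 1
    rw [Fin.prod_univ_succ]
    simp only [hsucc, ← hC, Fin.zero_le, Finset.filter_true, Fin.sum_univ_succ r]
    ring

/-- The probability that independent exponential variables with rates `r 0, …, r (N - 1)` satisfy
`X 0 < ⋯ < X (N - 1)`. -/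
lemma pi_expMeasure_strictMono {N : ℕ} (r : Fin N → ℝ) (hr : ∀ i, 0 < r i) :
    (Measure.pi fun i => expMeasure (r i)) {x | StrictMono x} =
      ENNReal.ofReal (∏ i, r i * (∑ j with i ≤ j, r j)⁻¹) := by
  have (i : Fin N) := isProbabilityMeasure_expMeasure (hr i)
  have h := pi_expMeasure_strictMono_vecCons r hr le_rfl
  rw [mul_zero, neg_zero, Real.exp_zero, mul_one] at h
  rw [← h]
  refine measure_congr ?_
  have hpos : ∀ᵐ x ∂(Measure.pi fun i => expMeasure (r i)), ∀ i, 0 < x i :=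
    ae_all_iff.2 fun i => Measure.tendsto_eval_ae_ae.eventually (ae_expMeasure_pos (r i))
  filter_upwards [hpos] with x hx
  refine propext ?_
  change StrictMono x ↔ StrictMono (Matrix.vecCons 0 x)
  cases N with
  | zero => exact ⟨fun _ i j hij => absurd hij (by omega), fun _ i => i.elim0⟩
  | succ N => exact ⟨fun h => strictMono_vecCons.2 ⟨hx 0, h⟩, fun h => (strictMono_vecCons.1 h).2⟩

/-- The probability that independent exponential variables are ordered by the permutation `σ`. -/
lemma pi_expMeasure_strictMono_comp_perm {N : ℕ} (r : Fin N → ℝ) (hr : ∀ i, 0 < r i)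
    (σ : Equiv.Perm (Fin N)) :
    (Measure.pi fun i => expMeasure (r i)) {x | StrictMono (x ∘ σ)} =
      ENNReal.ofReal (∏ i, r (σ i) * (∑ j with i ≤ j, r (σ j))⁻¹) := by
  have (i : Fin N) := isProbabilityMeasure_expMeasure (hr i)
  rw [← pi_expMeasure_strictMono (fun i => r (σ i)) fun i => hr _,
    ← (measurePreserving_piCongrLeft (fun i => expMeasure (r i)) σ).measure_preimage_equiv]
  congr 1
  ext x
  have hx : MeasurableEquiv.piCongrLeft (fun _ => ℝ) σ x ∘ σ = x :=
    funext fun i => Equiv.piCongrLeft_apply_apply (P := fun _ => ℝ) σ x i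
  change StrictMono (MeasurableEquiv.piCongrLeft (fun _ => ℝ) σ x ∘ σ) ↔ StrictMono x
  rw [hx]

lemma perm_eq_of_strictMono_comp {N : ℕ} {x : Fin N → ℝ} {σ τ : Equiv.Perm (Fin N)}
    (hσ : StrictMono (x ∘ σ)) (hτ : StrictMono (x ∘ τ)) : σ = τ := by
  have hinj : Function.Injective x := (Equiv.injective_comp σ x).1 hσ.injective
  have h := Tuple.unique_monotone hσ.monotone hτ.monotone
  exact Equiv.ext fun i => hinj (congrFun h i)

lemma card_perm_comp_eq_s13 {α ι : Type*} [Fintype α] [DecidableEq α] [Fintype ι] [DecidableEq ι]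
    (f g : α → ι) (σ : Equiv.Perm α) (hσ : f ∘ σ = g) :
    (Finset.univ.filter fun τ : Equiv.Perm α => f ∘ τ = g).card =
      ∏ i, (Fintype.card {a // f a = i}).factorial := by
  rw [← DomMulAct.stabilizer_card f, Fintype.card_subtype, ← hσ]
  refine Finset.card_equiv (Equiv.mulRight σ⁻¹) fun τ => ?_
  simp only [Finset.mem_filter, Finset.mem_univ, true_and, Equiv.coe_mulRight, Equiv.Perm.coe_mul,
    ← Function.comp_assoc]
  exact (Equiv.comp_symm_eq σ f (f ∘ τ)).symm

lemma card_fin_two_mul_lt (n : ℕ) :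
    (Finset.univ.filter fun i : Fin (2 * n) => (i : ℕ) < n).card = n := by
  rw [Fin.card_filter_val_lt]
  omega

lemma card_filter_not_of_card_filter {n : ℕ} (p : Fin (2 * n) → Prop) [DecidablePred p]
    (h : (Finset.univ.filter p).card = n) : (Finset.univ.filter fun i => ¬ p i).card = n := by
  have := Finset.card_filter_add_card_filter_not (s := Finset.univ) p
  rw [Finset.card_fin, h] at this
  omega

lemma card_perm_of_isWord {n : ℕ} {u : Fin (2 * n) → Bool} (hu : IsWord n u) :
    (Finset.univ.filter fun σ : Equiv.Perm (Fin (2 * n)) =>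
      ∀ i, u i = decide ((σ i : ℕ) < n)).card = n.factorial ^ 2 := by
  have hcard : Fintype.card {i // u i = true} = Fintype.card {i : Fin (2 * n) // (i : ℕ) < n} := by
    rw [Fintype.card_subtype, Fintype.card_subtype, card_fin_two_mul_lt]
    exact hu
  let e := Fintype.equivOfCardEq hcard
  let σ := e.extendSubtype
  let f : Fin (2 * n) → Bool := fun i => decide ((i : ℕ) < n)
  have hσ : f ∘ σ = u := by
    funext i
    by_cases hi : u i = true
    · rw [hi]
      exact decide_eq_true (e.extendSubtype_mem i hi)
    · rw [Bool.eq_false_iff.2 hi]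
      exact decide_eq_false (e.extendSubtype_not_mem i hi)
  have h := card_perm_comp_eq_s13 f u σ hσ
  simp only [funext_iff, Function.comp_apply, f, Fintype.card_subtype, Fintype.prod_bool,
    decide_eq_true_eq, decide_eq_false_iff_not, card_fin_two_mul_lt,
    card_filter_not_of_card_filter _ (card_fin_two_mul_lt n)] at h
  rw [sq, ← h]
  simp only [eq_comm]

lemma interleavingSet_eq_biUnion (m : ℕ) (w : Fin (2 * m) → Bool) :
    interleavingSet m w = ⋃ σ ∈ Finset.univ.filter fun σ : Equiv.Perm (Fin (2 * m)) =>
      ∀ i, w i = decide ((σ i : ℕ) < m), {p | StrictMono (p ∘ σ)} := by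
  ext p
  simp [interleavingSet, and_comm]

/-- For exponential distributions with rates `α, β > 0` and any `u ∈ W_n`,
`Exp(α)^{⊗n} ⊗ Exp(β)^{⊗n}(S(u)) = (n!)² αⁿ βⁿ ∏_{i=1}^{2n} 1/(A_i^n(u)·α + B_i^n(u)·β)`,
where `A_i^n(u) = #{i ≤ j ≤ 2n : u_j = a}` and `B_i^n(u) = #{i ≤ j ≤ 2n : u_j = b}`. -/
theorem exponential_interleavingSet (α β : ℝ) (hα : 0 < α) (hβ : 0 < β)
    (n : ℕ) (u : Fin (2*n) → Bool) (hu : IsWord n u) :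
    (Measure.pi fun i : Fin (2*n) =>
        if (i : ℕ) < n then expMeasure α else expMeasure β)
      (interleavingSet n u)
      = ENNReal.ofReal ((n.factorial : ℝ)^2 * α^n * β^n *
          ∏ i : Fin (2*n),
            (((Finset.univ.filter fun j => i ≤ j ∧ u j = true).card : ℝ) * α
              + ((Finset.univ.filter fun j => i ≤ j ∧ u j = false).card : ℝ) * β)⁻¹) := by
  set r : Fin (2 * n) → ℝ := fun i => if (i : ℕ) < n then α else β with hr
  have hpos (i : Fin (2 * n)) : 0 < r i := by
    simp only [hr]
    split_ifs <;> assumption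
  have hμ : (fun i : Fin (2*n) => if (i : ℕ) < n then expMeasure α else expMeasure β) =
      fun i => expMeasure (r i) :=
    funext fun i => (apply_ite expMeasure _ _ _).symm
  have hword {σ : Equiv.Perm (Fin (2 * n))} (hσ : ∀ i, u i = decide ((σ i : ℕ) < n)) :
      ∏ i, r (σ i) * (∑ j with i ≤ j, r (σ j))⁻¹ = α ^ n * β ^ n * ∏ i : Fin (2*n),
        (((Finset.univ.filter fun j => i ≤ j ∧ u j = true).card : ℝ) * α
          + ((Finset.univ.filter fun j => i ≤ j ∧ u j = false).card : ℝ) * β)⁻¹ := by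
    have hrσ (j : Fin (2 * n)) : r (σ j) = if u j = true then α else β := by
      simp [hr, hσ j]
    rw [Finset.prod_mul_distrib, Equiv.prod_comp σ r]
    congr 1
    · simp only [hr]
      rw [Finset.prod_ite, Finset.prod_const, Finset.prod_const, card_fin_two_mul_lt,
        card_filter_not_of_card_filter _ (card_fin_two_mul_lt n)]
    · refine Finset.prod_congr rfl fun i _ => ?_
      simp only [hrσ]
      rw [Finset.sum_ite, Finset.sum_const, Finset.sum_const, Finset.filter_filter,
        Finset.filter_filter, nsmul_eq_mul, nsmul_eq_mul]
      simp only [Bool.not_eq_true]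
  rw [hμ, interleavingSet_eq_biUnion, measure_biUnion_finset]
  · rw [Finset.sum_congr rfl fun σ hσ => (pi_expMeasure_strictMono_comp_perm r hpos σ).trans
      (congrArg ENNReal.ofReal (hword (Finset.mem_filter.1 hσ).2)), Finset.sum_const,
      card_perm_of_isWord hu, ← ENNReal.ofReal_nsmul, nsmul_eq_mul]
    push_cast
    ring_nf
  · intro σ _ τ _ hne
    exact Set.disjoint_left.2 fun x hσ hτ => hne (perm_eq_of_strictMono_comp hσ hτ)
  · intro σ _
    exact measurableSet_setOf_strictMono.preimage
      (measurable_pi_iff.2 fun i => measurable_pi_apply (σ i))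
end

section
/- Let α, β > 0 and for w = w_1⋯w_{2m} ∈ W_m define h(w) := (2m)! α^m β^m ∏_{i=1}^{2m} 1/(A_i^m(w)·α + B_i^m(w)·β), where A_i^m(w) := #{i ≤ j ≤ 2m : w_j = a} and B_i^m(w) := #{i ≤ j ≤ 2m : w_j = b} (with h(∅) = 1). Then h is harmonic for the growing word chain: for every m ∈ ℕ and every w ∈ W_m, the sum over all v ∈ W_{m+1} of binom(v,w)·h(v) equals (2m+2)(2m+1)·h(w). -/
open MeasureTheory ProbabilityTheory
open scoped ENNReal

/-- The Plackett–Luce function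
`h(w) = (2m)! α^m β^m ∏_{i=1}^{2m} 1/(A_i^m(w)·α + B_i^m(w)·β)` for `w ∈ W_m`, where
`A_i^m(w) = #{i ≤ j ≤ 2m : w_j = a}` and `B_i^m(w) = #{i ≤ j ≤ 2m : w_j = b}`
(so `h(∅) = 1`). -/
noncomputable def plackettLuce (α β : ℝ) (m : ℕ) (w : Fin (2*m) → Bool) : ℝ :=
  ((2*m).factorial : ℝ) * α^m * β^m *
    ∏ i : Fin (2*m),
      (((Finset.univ.filter fun j => i ≤ j ∧ w j = true).card : ℝ) * α
        + ((Finset.univ.filter fun j => i ≤ j ∧ w j = false).card : ℝ) * β)⁻¹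

/-- The number of occurrences of the letter `b` in the word `v`. -/
def letterCount {n : ℕ} (b : Bool) (v : Fin n → Bool) : ℕ :=
  (Finset.univ.filter fun i => v i = b).card

/-- The product over all nonempty suffixes of `v` of the inverse weight of the suffix, where
letters `true` and `false` have weights `α` and `β`. -/
noncomputable def suffixProd (α β : ℝ) {n : ℕ} (v : Fin n → Bool) : ℝ :=
  ∏ i : Fin n,
    (((Finset.univ.filter fun j => i ≤ j ∧ v j = true).card : ℝ) * α
      + ((Finset.univ.filter fun j => i ≤ j ∧ v j = false).card : ℝ) * β)⁻¹

theorem letterCount_cons {n : ℕ} (b c : Bool) (v : Fin n → Bool) :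
    letterCount b (Fin.cons c v : Fin (n + 1) → Bool) =
      letterCount b v + if c = b then 1 else 0 := by
  simp [letterCount, Finset.card_filter, Fin.sum_univ_succ, -Finset.sum_boole, add_comm]

theorem letterCount_true_add_false {n : ℕ} (v : Fin n → Bool) :
    letterCount true v + letterCount false v = n := by
  have h := Finset.card_filter_add_card_filter_not (s := (Finset.univ : Finset (Fin n)))
    (fun i => v i = true)
  simpa [letterCount] using h

theorem suffixProd_cons (α β : ℝ) {n : ℕ} (c : Bool) (v : Fin n → Bool) :
    suffixProd α β (Fin.cons c v : Fin (n + 1) → Bool) =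
      ((letterCount true (Fin.cons c v : Fin (n + 1) → Bool) : ℝ) * α
        + (letterCount false (Fin.cons c v : Fin (n + 1) → Bool) : ℝ) * β)⁻¹ *
      suffixProd α β v := by
  rw [suffixProd, Fin.prod_univ_succ, suffixProd]
  congr 1
  · simp [letterCount]
  · refine Finset.prod_congr rfl fun i _ => ?_
    simp [Finset.card_filter, Fin.sum_univ_succ, -Finset.sum_boole]

theorem subwordCount_empty {n : ℕ} (v : Fin n → Bool) (w : Fin 0 → Bool) :
    subwordCount v w = 1 := by
  rw [subwordCount, Nat.card_eq_one_iff_unique]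
  exact ⟨⟨fun a b => Subtype.ext (Subsingleton.elim _ _)⟩,
    ⟨⟨Fin.elim0, fun i => i.elim0, fun i => i.elim0⟩⟩⟩

theorem subwordCount_eq_zero {n k : ℕ} (b : Bool) (v : Fin n → Bool) (w : Fin k → Bool)
    (h : letterCount b v < letterCount b w) : subwordCount v w = 0 := by
  rw [subwordCount, Nat.card_eq_zero]
  refine Or.inl ⟨fun ⟨f, hf, hv⟩ => h.not_ge ?_⟩
  exact Finset.card_le_card_of_injOn f (fun i hi => by simpa [hv] using hi) hf.injective.injOn

theorem subwordCount_cons_cons {n k : ℕ} (c d : Bool) (v : Fin n → Bool) (w : Fin k → Bool) :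
    subwordCount (Fin.cons c v : Fin (n + 1) → Bool) (Fin.cons d w : Fin (k + 1) → Bool) =
      subwordCount v (Fin.cons d w : Fin (k + 1) → Bool) +
        if c = d then subwordCount v w else 0 := by
  have key : {f : Fin (k + 1) → Fin (n + 1) | StrictMono f ∧
      ∀ i, (Fin.cons c v : Fin (n + 1) → Bool) (f i) = (Fin.cons d w : Fin (k + 1) → Bool) i} =
      (fun g : Fin (k + 1) → Fin n => Fin.succ ∘ g) '' {g | StrictMono g ∧
        ∀ i, v (g i) = (Fin.cons d w : Fin (k + 1) → Bool) i} ∪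
      (fun g : Fin k → Fin n => (Fin.cons 0 (Fin.succ ∘ g) : Fin (k + 1) → Fin (n + 1))) ''
        {g | c = d ∧ StrictMono g ∧ ∀ i, v (g i) = w i} := by
    ext f
    constructor
    · rintro ⟨hf, hv⟩
      by_cases h0 : f 0 = 0
      · right
        have hne : ∀ i : Fin k, f i.succ ≠ 0 := fun i =>
          ((Fin.zero_le _).trans_lt (hf i.succ_pos)).ne'
        refine ⟨fun i => (f i.succ).pred (hne i), ⟨?_, ?_, ?_⟩, ?_⟩
        · simpa [h0] using hv 0
        · intro i j hij
          exact Fin.pred_lt_pred_iff.2 (hf (Fin.succ_lt_succ_iff.2 hij))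
        · intro i
          have := hv i.succ
          rwa [← Fin.succ_pred _ (hne i), Fin.cons_succ, Fin.cons_succ] at this
        · funext i
          refine Fin.cases ?_ (fun i => ?_) i <;> simp [h0]
      · left
        have hne : ∀ i, f i ≠ 0 := fun i h =>
          h0 (le_antisymm (h ▸ hf.monotone (Fin.zero_le i)) (Fin.zero_le _))
        refine ⟨fun i => (f i).pred (hne i), ⟨?_, ?_⟩, ?_⟩
        · intro i j hij
          exact Fin.pred_lt_pred_iff.2 (hf hij)
        · intro i
          have := hv i
          rwa [← Fin.succ_pred _ (hne i), Fin.cons_succ] at this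
        · funext i
          simp
    · rintro (⟨g, ⟨hg, hv⟩, rfl⟩ | ⟨g, ⟨rfl, hg, hv⟩, rfl⟩)
      · exact ⟨Fin.strictMono_succ.comp hg, fun i => by simpa using hv i⟩
      · refine ⟨?_, fun i => ?_⟩
        · intro i j
          refine Fin.cases ?_ (fun i => ?_) i <;> refine Fin.cases ?_ (fun j => ?_) j
          · simp
          · simp
          · simp
          · simpa using @hg i j
        · refine Fin.cases ?_ (fun i => ?_) i <;> simp [hv]
  have hdisj : Disjoint
      ((fun g : Fin (k + 1) → Fin n => Fin.succ ∘ g) '' {g | StrictMono g ∧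
        ∀ i, v (g i) = (Fin.cons d w : Fin (k + 1) → Bool) i})
      ((fun g : Fin k → Fin n => (Fin.cons 0 (Fin.succ ∘ g) : Fin (k + 1) → Fin (n + 1))) ''
        {g | c = d ∧ StrictMono g ∧ ∀ i, v (g i) = w i}) := by
    rw [Set.disjoint_left]
    rintro _ ⟨g, -, rfl⟩ ⟨g', -, h⟩
    exact Fin.succ_ne_zero _ (congrFun h 0).symm
  have hcard := congrArg Set.ncard key
  rw [Set.ncard_union_eq hdisj (Set.toFinite _) (Set.toFinite _),
    Set.ncard_image_of_injective _ fun g g' h => (Fin.succ_injective n).comp_left h,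
    Set.ncard_image_of_injective _ fun g g' h =>
      (Fin.succ_injective n).comp_left (Fin.cons_right_injective _ h)] at hcard
  refine hcard.trans (congrArg₂ _ rfl ?_)
  split_ifs with h
  · simp only [h, true_and]
    rfl
  · simp [h]

/-- Summing over all words `v` with `x` letters `true` against the suffix product: splitting off
the first letter of `v`. -/
theorem sum_letterCount_cons (α β : ℝ) {n k : ℕ} (x y : ℕ) (hxy : x + y = n + 1)
    (w : Fin k → Bool) :
    ∑ v : Fin (n + 1) → Bool with letterCount true v = x,
        (subwordCount v w : ℝ) * suffixProd α β v =
      (x * α + y * β)⁻¹ *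
      (∑ v : Fin n → Bool with letterCount true v + 1 = x,
          (subwordCount (Fin.cons true v : Fin (n + 1) → Bool) w : ℝ) * suffixProd α β v +
        ∑ v : Fin n → Bool with letterCount true v = x,
          (subwordCount (Fin.cons false v : Fin (n + 1) → Bool) w : ℝ) * suffixProd α β v) := by
  have hcons : ∀ (b : Bool) (v : Fin n → Bool), (Fin.consEquiv fun _ : Fin (n + 1) => Bool) (b, v) =
      (Fin.cons b v : Fin (n + 1) → Bool) := fun _ _ => rfl
  simp only [Finset.sum_filter]
  rw [← (Fin.consEquiv fun _ : Fin (n + 1) => Bool).sum_comp, Fintype.sum_prod_type,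
    Fintype.sum_bool, mul_add, Finset.mul_sum, Finset.mul_sum]
  congr 1
  all_goals
    refine Finset.sum_congr rfl fun v _ => ?_
    have h := letterCount_true_add_false v
    simp only [hcons, suffixProd_cons, letterCount_cons, mul_ite, mul_zero]
    simp only [if_true, if_false, Bool.false_eq_true, Bool.true_eq_false, add_zero]
    split_ifs with hx
    · obtain rfl : y = letterCount false v + _ := by
        first
        | exact (by omega : y = letterCount false v + 0)
        | exact (by omega : y = letterCount false v + 1)
      subst hx
      push_cast
      ring
    · rfl

theorem sum_subwordCount_mul_suffixProd {α β : ℝ} (hα : 0 < α) (hβ : 0 < β) {n : ℕ} :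
    ∀ {k i j : ℕ} (w : Fin k → Bool), n = k + i + j →
      ∑ v : Fin n → Bool with letterCount true v = letterCount true w + i,
        (subwordCount v w : ℝ) * suffixProd α β v =
      suffixProd α β w / (i.factorial * j.factorial * α ^ i * β ^ j) := by
  induction n with
  | zero =>
    intro k i j w h
    obtain ⟨rfl, rfl, rfl⟩ : k = 0 ∧ i = 0 ∧ j = 0 := by omega
    simp [letterCount, subwordCount_empty, suffixProd]
  | succ n ih =>
    intro k i j w h
    have hw := letterCount_true_add_false w
    set Q := suffixProd α β w / (i.factorial * j.factorial * α ^ i * β ^ j) with hQ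
    have hA : ∑ v : Fin n → Bool with letterCount true v + 1 = letterCount true w + i,
        (subwordCount v w : ℝ) * suffixProd α β v = i * α * Q := by
      cases i with
      | zero =>
        rw [Finset.sum_eq_zero]
        · simp
        · intro v hv
          rw [subwordCount_eq_zero true v w (by simp at hv; omega)]
          simp
      | succ i =>
        have := ih (i := i) (j := j) w (by omega)
        simp only [← add_assoc, add_left_inj]
        rw [this, hQ, Nat.factorial_succ]
        push_cast
        field_simp
        ring
    have hB : ∑ v : Fin n → Bool with letterCount true v = letterCount true w + i,
        (subwordCount v w : ℝ) * suffixProd α β v = j * β * Q := by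
      cases j with
      | zero =>
        rw [Finset.sum_eq_zero]
        · simp
        · intro v hv
          have hv' := letterCount_true_add_false v
          rw [subwordCount_eq_zero false v w (by simp at hv; omega)]
          simp
      | succ j =>
        rw [ih (i := i) (j := j) w (by omega), hQ, Nat.factorial_succ]
        push_cast
        field_simp
        ring
    have hpos : 0 < ((letterCount true w + i : ℕ) : ℝ) * α +
        ((letterCount false w + j : ℕ) : ℝ) * β := by
      rcases Nat.eq_zero_or_pos (letterCount true w + i) with h0 | h0
      · have : 0 < letterCount false w + j := by omega
        positivity
      · positivity
    rw [sum_letterCount_cons α β _ (letterCount false w + j) (by omega), inv_mul_eq_iff_eq_mul₀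
      hpos.ne']
    cases k with
    | zero =>
      simp only [subwordCount_empty] at hA hB ⊢
      rw [hA, hB, show letterCount true w = 0 by omega, show letterCount false w = 0 by omega]
      push_cast
      ring
    | succ k =>
      obtain ⟨d, w, rfl⟩ : ∃ d w', w = (Fin.cons d w' : Fin (k + 1) → Bool) :=
        ⟨w 0, Fin.tail w, (Fin.cons_self_tail w).symm⟩
      have hC := ih (i := i) (j := j) w (by omega)
      have hS : suffixProd α β w / (i.factorial * j.factorial * α ^ i * β ^ j) =
          ((letterCount true (Fin.cons d w : Fin (k + 1) → Bool) : ℝ) * α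
            + (letterCount false (Fin.cons d w : Fin (k + 1) → Bool) : ℝ) * β) * Q := by
        have : ((letterCount true (Fin.cons d w : Fin (k + 1) → Bool) : ℝ) * α
            + (letterCount false (Fin.cons d w : Fin (k + 1) → Bool) : ℝ) * β) ≠ 0 := by
          refine ne_of_gt ?_
          rcases Nat.eq_zero_or_pos
            (letterCount true (Fin.cons d w : Fin (k + 1) → Bool)) with h0 | h0
          · have : 0 < letterCount false (Fin.cons d w : Fin (k + 1) → Bool) := by omega
            positivity
          · positivity
        rw [hQ, suffixProd_cons]
        field_simp
      rw [hS] at hC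
      simp only [subwordCount_cons_cons, Nat.cast_add, add_mul, Finset.sum_add_distrib]
      rw [hA, hB]
      cases d
      · simp only [letterCount_cons, if_true, if_false, Bool.false_eq_true, Bool.true_eq_false,
          add_zero] at hC ⊢
        rw [hC]
        push_cast
        simp
        ring
      · simp only [letterCount_cons, if_true, if_false, Bool.false_eq_true, Bool.true_eq_false,
          add_zero, add_right_comm _ 1 i, add_left_inj] at hC ⊢
        rw [hC]
        push_cast
        simp
        ring

/-- For `α, β > 0` the Plackett–Luce function is harmonic for the growing word chain:
for every `w ∈ W_m`, `∑_{v ∈ W_{m+1}} binom(v,w)·h(v) = (2m+2)(2m+1)·h(w)`. -/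
theorem plackettLuce_harmonic (α β : ℝ) (hα : 0 < α) (hβ : 0 < β)
    (m : ℕ) (w : Fin (2*m) → Bool) (hw : IsWord m w) :
    ∑ v ∈ Finset.univ.filter (IsWord (m+1)),
        (subwordCount v w : ℝ) * plackettLuce α β (m+1) v
      = (2*(m:ℝ)+2) * (2*(m:ℝ)+1) * plackettLuce α β m w := by
  have h := sum_subwordCount_mul_suffixProd hα hβ (n := 2 * (m + 1)) (i := 1) (j := 1) w (by ring)
  have hw' : letterCount true w = m := hw
  rw [hw'] at h
  have hP : ∀ (l : ℕ) (v : Fin (2 * l) → Bool), plackettLuce α β l v =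
      ((2 * l).factorial : ℝ) * α ^ l * β ^ l * suffixProd α β v := fun _ _ => rfl
  have hfac : ((2 * (m + 1)).factorial : ℝ) =
      (2 * (m : ℝ) + 2) * (2 * (m : ℝ) + 1) * ((2 * m).factorial : ℝ) := by
    rw [show 2 * (m + 1) = 2 * m + 1 + 1 by ring, Nat.factorial_succ, Nat.factorial_succ]
    push_cast
    ring
  calc _ = ((2 * (m + 1)).factorial : ℝ) * α ^ (m + 1) * β ^ (m + 1) *
        ∑ v : Fin (2 * (m + 1)) → Bool with letterCount true v = m + 1,
          (subwordCount v w : ℝ) * suffixProd α β v := by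
        rw [Finset.mul_sum]
        refine Finset.sum_congr (Finset.filter_congr fun _ _ => Iff.rfl) fun v _ => ?_
        rw [hP]
        ring
    _ = _ := by
        rw [h, hP, hfac]
        simp only [Nat.factorial_one, Nat.cast_one, one_mul, pow_one]
        field_simp
        ring
end
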